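/- Let W be a classical-quantum channel with input alphabet X = {1,…,k} and output dimension d, and let p be a probability vector on X with W_p := ∑_i p_i W(i). Then for every t ∈ (0,1), Tr[(∑_{i=1}^k p_i W(i)^{1−t}) W_p^t] ≤ (Tr[(∑_{i=1}^k p_i W(i)^{1−t})^{1/(1−t)}])^{1−t}. -/

import Mathlib

open Matrix
open scoped ComplexOrder

open Classical in
/-- The power `A^s` of a positive semidefinite (more generally Hermitian) matrix,
obtained by applying `x ↦ x ^ s` to the eigenvalues in a spectral decomposition. -/
noncomputable def matRpow {ι : Type*} [Fintype ι] [DecidableEq ι]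
    (A : Matrix ι ι ℂ) (s : ℝ) : Matrix ι ι ℂ :=
  if hA : A.IsHermitian then
    (hA.eigenvectorUnitary : Matrix ι ι ℂ) *
      Matrix.diagonal (fun i => ((hA.eigenvalues i ^ s : ℝ) : ℂ)) *
      star (hA.eigenvectorUnitary : Matrix ι ι ℂ)
  else 0

theorem matRpow_eq {ι : Type*} [Fintype ι] [DecidableEq ι]
    {A : Matrix ι ι ℂ} (hA : A.IsHermitian) (s : ℝ) :
    matRpow A s = (hA.eigenvectorUnitary : Matrix ι ι ℂ) *
      Matrix.diagonal (fun i => ((hA.eigenvalues i ^ s : ℝ) : ℂ)) *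
      star (hA.eigenvectorUnitary : Matrix ι ι ℂ) :=
  dif_pos hA

theorem matRpow_one {ι : Type*} [Fintype ι] [DecidableEq ι]
    {A : Matrix ι ι ℂ} (hA : A.IsHermitian) : matRpow A 1 = A := by
  rw [matRpow_eq hA]
  conv_rhs => rw [hA.spectral_theorem]
  simp [Unitary.conjStarAlgAut_apply, Function.comp_def]

theorem posSemidef_matRpow {ι : Type*} [Fintype ι] [DecidableEq ι]
    {A : Matrix ι ι ℂ} (hA : A.PosSemidef) (s : ℝ) : (matRpow A s).PosSemidef := by
  rw [matRpow_eq hA.isHermitian]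
  refine PosSemidef.mul_mul_conjTranspose_same (PosSemidef.diagonal fun i => ?_) _
  exact Complex.zero_le_real.2 (Real.rpow_nonneg (hA.eigenvalues_nonneg i) s)

theorem trace_matRpow_re {ι : Type*} [Fintype ι] [DecidableEq ι]
    {A : Matrix ι ι ℂ} (hA : A.IsHermitian) (s : ℝ) :
    (matRpow A s).trace.re = ∑ i, hA.eigenvalues i ^ s := by
  rw [matRpow_eq hA, Matrix.trace_mul_comm, ← Matrix.mul_assoc, Unitary.coe_star_mul_self]
  simp [Matrix.trace, ← Complex.ofReal_sum]

/-- The trace of a product of two diagonalized matrices in terms of the overlaps of the two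
eigenbases. -/
theorem trace_conj_diagonal_mul_re {ι : Type*} [Fintype ι] [DecidableEq ι]
    (U V : Matrix ι ι ℂ) (a b : ι → ℝ) :
    ((U * diagonal (fun i => (a i : ℂ)) * star U *
      (V * diagonal (fun i => (b i : ℂ)) * star V)).trace).re =
      ∑ i, ∑ j, a i * b j * Complex.normSq ((star U * V) i j) := by
  have h : (U * diagonal (fun i => (a i : ℂ)) * star U *
      (V * diagonal (fun i => (b i : ℂ)) * star V)).trace =
      (diagonal (fun i => (a i : ℂ)) * (star U * V) *
        (diagonal (fun i => (b i : ℂ)) * star (star U * V))).trace := by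
    rw [star_mul, star_star, Matrix.mul_assoc, Matrix.mul_assoc, Matrix.trace_mul_comm]
    simp only [Matrix.mul_assoc]
  rw [h]
  generalize star U * V = M
  simp only [Matrix.trace, Matrix.diag_apply, Matrix.mul_apply (M := diagonal _ * M),
    Matrix.diagonal_mul, Matrix.star_apply, Complex.re_sum]
  refine Finset.sum_congr rfl fun i _ => Finset.sum_congr rfl fun j _ => ?_
  simp [Complex.normSq_apply]
  ring

theorem sum_normSq_row_eq_one {ι : Type*} [Fintype ι] [DecidableEq ι]
    {M : Matrix ι ι ℂ} (hM : M * star M = 1) (i : ι) :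
    ∑ j, Complex.normSq (M i j) = 1 := by
  have h := congrArg Complex.re (congrFun (congrFun hM i) i)
  simpa [Matrix.mul_apply, Complex.normSq_apply] using h

theorem sum_normSq_col_eq_one {ι : Type*} [Fintype ι] [DecidableEq ι]
    {M : Matrix ι ι ℂ} (hM : star M * M = 1) (j : ι) :
    ∑ i, Complex.normSq (M i j) = 1 := by
  have h := congrArg Complex.re (congrFun (congrFun hM j) j)
  simpa [Matrix.mul_apply, Complex.normSq_apply] using h

/-- The Hölder inequality with a doubly stochastic weight. -/
theorem sum_mul_rpow_mul_le_of_doublyStochastic {ι : Type*} [Fintype ι]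
    {a b : ι → ℝ} {w : ι → ι → ℝ} (ha : ∀ i, 0 ≤ a i) (hb : ∀ i, 0 ≤ b i)
    (hw : ∀ i j, 0 ≤ w i j) (hrow : ∀ i, ∑ j, w i j = 1) (hcol : ∀ j, ∑ i, w i j = 1)
    {t : ℝ} (ht0 : 0 < t) (ht1 : t < 1) :
    ∑ i, ∑ j, a i * b j ^ t * w i j ≤
      (∑ i, a i ^ (1 / (1 - t))) ^ (1 - t) * (∑ j, b j) ^ t := by
  have hs : 0 < 1 - t := sub_pos.2 ht1
  have hpq : (1 / (1 - t)).HolderConjugate (1 / t) := by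
    rw [Real.holderConjugate_iff]
    refine ⟨by rw [lt_div_iff₀ hs]; linarith, by simp⟩
  have key := Real.inner_le_Lp_mul_Lq_of_nonneg (Finset.univ : Finset (ι × ι)) hpq
    (f := fun x => a x.1 * w x.1 x.2 ^ (1 - t)) (g := fun x => b x.2 ^ t * w x.1 x.2 ^ t)
    (fun x _ => mul_nonneg (ha _) (Real.rpow_nonneg (hw _ _) _))
    (fun x _ => mul_nonneg (Real.rpow_nonneg (hb _) _) (Real.rpow_nonneg (hw _ _) _))
  have hl : ∀ i j, a i * w i j ^ (1 - t) * (b j ^ t * w i j ^ t) = a i * b j ^ t * w i j := by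
    intro i j
    have : w i j ^ (1 - t) * w i j ^ t = w i j := by
      rw [← Real.rpow_add' (hw i j) (by simp)]; simp
    linear_combination a i * b j ^ t * this
  have hf : ∀ i j, (a i * w i j ^ (1 - t)) ^ (1 / (1 - t)) = a i ^ (1 / (1 - t)) * w i j := by
    intro i j
    rw [Real.mul_rpow (ha i) (Real.rpow_nonneg (hw i j) _), ← Real.rpow_mul (hw i j),
      mul_one_div_cancel hs.ne', Real.rpow_one]
  have hg : ∀ i j, (b j ^ t * w i j ^ t) ^ (1 / t) = b j * w i j := by
    intro i j
    rw [← Real.mul_rpow (hb j) (hw i j), ← Real.rpow_mul (mul_nonneg (hb j) (hw i j)),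
      mul_one_div_cancel ht0.ne', Real.rpow_one]
  simp only [hl, hf, hg, one_div_one_div] at key
  rw [Fintype.sum_prod_type, Fintype.sum_prod_type, Fintype.sum_prod_type_right] at key
  simpa only [← Finset.mul_sum, hrow, hcol, mul_one] using key

/-- The Hölder inequality for the trace of a product of positive semidefinite matrices. -/
theorem trace_mul_matRpow_le {ι : Type*} [Fintype ι] [DecidableEq ι]
    {A B : Matrix ι ι ℂ} (hA : A.PosSemidef) (hB : B.PosSemidef)
    {t : ℝ} (ht0 : 0 < t) (ht1 : t < 1) :
    ((A * matRpow B t).trace).re ≤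
      (matRpow A (1 / (1 - t))).trace.re ^ (1 - t) * B.trace.re ^ t := by
  have hU : (hA.isHermitian.eigenvectorUnitary : Matrix ι ι ℂ) *
      star (hA.isHermitian.eigenvectorUnitary : Matrix ι ι ℂ) = 1 := Unitary.coe_mul_star_self _
  have hUstar : star (hA.isHermitian.eigenvectorUnitary : Matrix ι ι ℂ) *
      (hA.isHermitian.eigenvectorUnitary : Matrix ι ι ℂ) = 1 := Unitary.coe_star_mul_self _
  have hV : (hB.isHermitian.eigenvectorUnitary : Matrix ι ι ℂ) *
      star (hB.isHermitian.eigenvectorUnitary : Matrix ι ι ℂ) = 1 := Unitary.coe_mul_star_self _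
  have hVstar : star (hB.isHermitian.eigenvectorUnitary : Matrix ι ι ℂ) *
      (hB.isHermitian.eigenvectorUnitary : Matrix ι ι ℂ) = 1 := Unitary.coe_star_mul_self _
  have hBtr : B.trace.re = ∑ i, hB.isHermitian.eigenvalues i := by
    simpa [matRpow_one hB.isHermitian] using trace_matRpow_re hB.isHermitian 1
  have hprod : (A * matRpow B t).trace = (matRpow A 1 * matRpow B t).trace := by
    rw [matRpow_one hA.isHermitian]
  rw [hprod, hBtr, trace_matRpow_re hA.isHermitian, matRpow_eq hA.isHermitian,
    matRpow_eq hB.isHermitian, trace_conj_diagonal_mul_re]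
  simp only [Real.rpow_one]
  refine sum_mul_rpow_mul_le_of_doublyStochastic hA.eigenvalues_nonneg hB.eigenvalues_nonneg
    (fun _ _ => Complex.normSq_nonneg _) (sum_normSq_row_eq_one ?_)
    (sum_normSq_col_eq_one ?_) ht0 ht1
  · rw [star_mul, star_star, Matrix.mul_assoc, ← Matrix.mul_assoc _ (star _), hV,
      Matrix.one_mul, hUstar]
  · rw [star_mul, star_star, Matrix.mul_assoc, ← Matrix.mul_assoc _ (star _), hU,
      Matrix.one_mul, hVstar]

/-- For a classical-quantum channel `W` and a probability vector `p`, with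
`W_p = ∑ᵢ pᵢ W(i)`, for every `t ∈ (0,1)`,
`Tr[(∑ᵢ pᵢ W(i)^{1-t}) W_pᵗ] ≤ (Tr[(∑ᵢ pᵢ W(i)^{1-t})^{1/(1-t)}])^{1-t}`. -/
theorem trace_vs_sup (k d : ℕ) (W : Fin k → Matrix (Fin d) (Fin d) ℂ)
    (hW : ∀ i, (W i).PosSemidef ∧ (W i).trace = 1)
    (p : Fin k → ℝ) (hp : ∀ i, 0 ≤ p i) (hp1 : ∑ i, p i = 1)
    (t : ℝ) (ht : t ∈ Set.Ioo (0 : ℝ) 1) :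
    (((∑ i, (p i : ℂ) • matRpow (W i) (1 - t)) *
        matRpow (∑ j, (p j : ℂ) • W j) t).trace).re ≤
      ((matRpow (∑ i, (p i : ℂ) • matRpow (W i) (1 - t)) (1 / (1 - t))).trace.re)
        ^ (1 - t) := by
  have hsum : ∀ M : Fin k → Matrix (Fin d) (Fin d) ℂ, (∀ i, (M i).PosSemidef) →
      (∑ i, (p i : ℂ) • M i).PosSemidef := fun M hM =>
    posSemidef_sum _ fun i _ => (hM i).smul (Complex.zero_le_real.2 (hp i))
  have htr : (∑ j, (p j : ℂ) • W j).trace.re = 1 := by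
    simp [trace_sum, trace_smul, (hW _).2, hp1]
  have h := trace_mul_matRpow_le
    (hsum _ fun i => posSemidef_matRpow (hW i).1 (1 - t)) (hsum _ fun i => (hW i).1) ht.1 ht.2
  rwa [htr, Real.one_rpow, mul_one] at h
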